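/- arXiv:1501.05049 — 2 statements merged into one kernel-verified Lean document; each statement's English description precedes it below -/
import Mathlib

section
/- Let S be a virtual flat biquandle and let C_n(S) be the free abelian group on n-tuples of elements of S (with C_0 = 0). Define ∂_n: C_n(S) → C_{n-1}(S) by ∂_n(a_1,...,a_n) = Σ_{i=1}^n (-1)^i [(a_1*a_i,...,a_{i-1}*a_i, a_{i+1},...,a_n) - (a_1,...,a_{i-1}, a_{i+1}∘a_i,...,a_n∘a_i)] for n ≥ 2 and ∂_n = 0 for n ≤ 1. Then ∂_{n-1} ∘ ∂_n = 0 for all n. -/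
/-- A virtual flat biquandle: a set with two binary operations
`star a b = S_b(a)` and `circ a b = T_b(a)` satisfying
(i) `S_a S_b = S_b S_a`, `T_a T_b = T_b T_a`, `S_a T_b = T_b S_a`;
(ii) `S_a = S_{T_b(a)} = S_{S_b(a)}`, `T_a = T_{S_b(a)} = T_{T_b(a)}`;
(iii) `T_a S_a = S_a T_a = id`. -/
structure VFB (S : Type*) where
  star : S → S → S
  circ : S → S → S
  star_star_comm : ∀ a b x, star (star x b) a = star (star x a) b
  circ_circ_comm : ∀ a b x, circ (circ x b) a = circ (circ x a) b
  star_circ_comm : ∀ a b x, star (circ x b) a = circ (star x a) b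
  star_circ_invar : ∀ a b x, star x (circ a b) = star x a
  star_star_invar : ∀ a b x, star x (star a b) = star x a
  circ_star_invar : ∀ a b x, circ x (star a b) = circ x a
  circ_circ_invar : ∀ a b x, circ x (circ a b) = circ x a
  circ_star : ∀ a x, circ (star x a) a = x
  star_circ : ∀ a x, star (circ x a) a = x

/-- the chain group `C_n(S)`: free abelian group on `n`-tuples of elements of `S` -/
def C (S : Type*) (n : ℕ) : Type _ := FreeAbelianGroup (Fin n → S)

instance (S : Type*) (n : ℕ) : AddCommGroup (C S n) :=
  inferInstanceAs (AddCommGroup (FreeAbelianGroup (Fin n → S)))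

variable {S : Type*}

/-- the tuple `(a_1*a_i, …, a_{i-1}*a_i, a_{i+1}, …, a_n)` -/
def leftFace (V : VFB S) {n : ℕ} (i : Fin (n + 1)) (a : Fin (n + 1) → S) :
    Fin n → S :=
  fun j => if (j : ℕ) < (i : ℕ) then V.star (a j.castSucc) (a i) else a j.succ

/-- the tuple `(a_1, …, a_{i-1}, a_{i+1}∘a_i, …, a_n∘a_i)` -/
def rightFace (V : VFB S) {n : ℕ} (i : Fin (n + 1)) (a : Fin (n + 1) → S) :
    Fin n → S :=
  fun j => if (j : ℕ) < (i : ℕ) then a j.castSucc else V.circ (a j.succ) (a i)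

/-- the boundary map `∂_{n+1} : C_{n+1}(S) → C_n(S)`,
`∂(a_1,…,a_n) = Σ_i (-1)^i [(a_1*a_i,…,a_{i-1}*a_i,a_{i+1},…,a_n)
  - (a_1,…,a_{i-1},a_{i+1}∘a_i,…,a_n∘a_i)]` -/
def bdry (V : VFB S) {n : ℕ} : C S (n + 1) →+ C S n :=
  FreeAbelianGroup.lift fun a : Fin (n + 1) → S =>
    ∑ i : Fin (n + 1),
      ((-1 : ℤ) ^ ((i : ℕ) + 1)) •
        (FreeAbelianGroup.of (leftFace V i a) - FreeAbelianGroup.of (rightFace V i a))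

/-- A family symmetric under the simplicial exchange of indices has vanishing alternating sum. -/
theorem alternating_double_sum_eq_zero {A : Type*} [AddCommGroup A] {n : ℕ}
    (f : Fin (n + 2) → Fin (n + 1) → A)
    (hf : ∀ i j : Fin (n + 1), i ≤ j → f j.succ i = f i.castSucc j) :
    ∑ p : Fin (n + 2), ∑ q : Fin (n + 1),
      ((-1 : ℤ) ^ ((p : ℕ) + 1)) • (((-1 : ℤ) ^ ((q : ℕ) + 1)) • f p q) = 0 := by
  rw [← Finset.sum_product']
  refine Finset.sum_involution
    (fun x _ => if h : x.2.castSucc < x.1 then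
      (x.2.castSucc, x.1.pred (Fin.ne_zero_of_lt h))
      else (x.2.succ, x.1.castPred (fun h' => h (h' ▸ Fin.castSucc_lt_last _)))) ?_ ?_ ?_ ?_
  · rintro ⟨p, q⟩ -
    by_cases h : q.castSucc < p
    · obtain ⟨j, rfl⟩ := Fin.exists_succ_eq.mpr (Fin.ne_zero_of_lt h)
      simp only [h, dite_true, Fin.pred_succ, Fin.val_succ, Fin.val_castSucc,
        hf q j (Fin.castSucc_lt_succ_iff.mp h), smul_smul, ← add_smul]
      convert zero_smul ℤ _ using 2
      ring
    · obtain ⟨j, rfl⟩ := Fin.exists_castSucc_eq.mpr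
        (fun h' : p = Fin.last _ => h (h' ▸ Fin.castSucc_lt_last _))
      simp only [h, dite_false, Fin.castPred_castSucc, Fin.val_succ, Fin.val_castSucc,
        hf j q (by simpa using h), smul_smul, ← add_smul]
      convert zero_smul ℤ _ using 2
      ring
  · rintro ⟨p, q⟩ - - h'
    by_cases h : q.castSucc < p
    · simp only [h, dite_true, Prod.mk.injEq] at h'
      exact h.ne h'.1
    · simp only [h, dite_false, Prod.mk.injEq] at h'
      exact h (h'.1 ▸ Fin.castSucc_lt_succ)
  · simp
  · rintro ⟨p, q⟩ -
    by_cases h : q.castSucc < p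
    · simp only [h, dite_true]
      have h2 : ¬ (p.pred (Fin.ne_zero_of_lt h)).castSucc < q.castSucc := by
        simp only [Fin.lt_def, Fin.val_castSucc, Fin.val_pred] at h ⊢
        omega
      simp only [Fin.castSucc_lt_castSucc_iff] at h2
      simp [h2]
    · have h2 : p < q.succ := by
        simp only [Fin.lt_def, Fin.val_castSucc, Fin.val_succ] at h ⊢
        omega
      simp [h, h2]

section Faces

variable (V : VFB S) {n : ℕ} {i j : Fin (n + 1)} (a : Fin (n + 2) → S)

theorem leftFace_leftFace (h : i ≤ j) :
    leftFace V i (leftFace V j.succ a) = leftFace V j (leftFace V i.castSucc a) := by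
  funext k
  have := V.star_star_comm
  have := V.star_star_invar
  simp only [leftFace, Fin.le_def, Fin.val_castSucc, Fin.val_succ] at *
  grind

theorem leftFace_rightFace (h : i ≤ j) :
    leftFace V i (rightFace V j.succ a) = rightFace V j (leftFace V i.castSucc a) := by
  funext k
  simp only [leftFace, rightFace, Fin.le_def, Fin.val_castSucc, Fin.val_succ] at *
  grind

theorem rightFace_leftFace (h : i ≤ j) :
    rightFace V i (leftFace V j.succ a) = leftFace V j (rightFace V i.castSucc a) := by
  funext k
  have := V.star_circ_comm
  have := V.star_circ_invar
  have := V.circ_star_invar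
  simp only [leftFace, rightFace, Fin.le_def, Fin.val_castSucc, Fin.val_succ] at *
  grind

theorem rightFace_rightFace (h : i ≤ j) :
    rightFace V i (rightFace V j.succ a) = rightFace V j (rightFace V i.castSucc a) := by
  funext k
  have := V.circ_circ_comm
  have := V.circ_circ_invar
  simp only [rightFace, Fin.le_def, Fin.val_castSucc, Fin.val_succ] at *
  grind

end Faces

/-- The basis element of `C S n` given by a tuple. -/
def C.of {n : ℕ} (a : Fin n → S) : C S n := FreeAbelianGroup.of a

theorem bdry_of (V : VFB S) {n : ℕ} (a : Fin (n + 1) → S) :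
    bdry V (C.of a) = ∑ i : Fin (n + 1),
      ((-1 : ℤ) ^ ((i : ℕ) + 1)) • (C.of (leftFace V i a) - C.of (rightFace V i a)) :=
  FreeAbelianGroup.lift_apply_of _ _

theorem bdry_bdry_of (V : VFB S) {n : ℕ} (a : Fin (n + 2) → S) :
    bdry V (bdry V (C.of a)) = 0 := by
  rw [bdry_of]
  simp only [map_sum, map_zsmul, map_sub, bdry_of, ← Finset.sum_sub_distrib, ← smul_sub,
    Finset.smul_sum]
  refine alternating_double_sum_eq_zero
    (fun p q => C.of (leftFace V q (leftFace V p a)) - C.of (rightFace V q (leftFace V p a)) -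
      (C.of (leftFace V q (rightFace V p a)) - C.of (rightFace V q (rightFace V p a))))
    fun i j h => ?_
  simp only [leftFace_leftFace V a h, leftFace_rightFace V a h, rightFace_leftFace V a h,
    rightFace_rightFace V a h]
  abel

theorem stmt_12 (V : VFB S) (n : ℕ) (x : C S (n + 2)) :
    bdry V (bdry V x) = 0 := by
  have h : (bdry V).comp (bdry V) = (0 : C S (n + 2) →+ C S n) :=
    FreeAbelianGroup.lift_ext _ _ fun a => bdry_bdry_of V a
  exact DFunLike.congr_fun h x
end

section
/- Let S be a virtual flat biquandle, C_n(S) the free abelian group on n-tuples from S, and define d_n: C_n(S) → C_{n-1}(S) by d_n(a_1,...,a_n) = Σ_{i=1}^{n-1} (-1)^i [(a_1,...,â_i,...,a_n) - (a_1,...,â_i,...,a_{n-1}, a_n∘a_i)], where â_i means a_i is omitted. Then d_{n-1} ∘ d_n = 0. -/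
variable {S : Type*}

/-- the tuple `(a_1, …, â_i, …, a_n)` (entry `a_i` omitted) -/
def delFace {n : ℕ} (i : Fin (n + 1)) (a : Fin (n + 1) → S) : Fin n → S :=
  fun j => if (j : ℕ) < (i : ℕ) then a j.castSucc else a j.succ

/-- the tuple `(a_1, …, â_i, …, a_{n-1}, a_n∘a_i)` -/
def delCircFace (V : VFB S) {n : ℕ} (i : Fin (n + 1)) (a : Fin (n + 1) → S) :
    Fin n → S :=
  fun j => if (j : ℕ) + 1 = n then V.circ (a (Fin.last n)) (a i)
    else if (j : ℕ) < (i : ℕ) then a j.castSucc else a j.succ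

/-- the boundary map `d_{n+1} : C_{n+1}(S) → C_n(S)`,
`d(a_1,…,a_n) = Σ_{i=1}^{n-1} (-1)^i [(a_1,…,â_i,…,a_n) - (a_1,…,â_i,…,a_{n-1},a_n∘a_i)]`
(the sum omits the last index). -/
def dbdry (V : VFB S) {n : ℕ} : C S (n + 1) →+ C S n :=
  FreeAbelianGroup.lift fun a : Fin (n + 1) → S =>
    ∑ i : Fin n,
      ((-1 : ℤ) ^ ((i : ℕ) + 1)) •
        (FreeAbelianGroup.of (delFace i.castSucc a) -
          FreeAbelianGroup.of (delCircFace V i.castSucc a))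

/-- A double alternating sum vanishes when its terms satisfy the presimplicial identities. -/
theorem Fin.sum_sum_alternating_eq_zero {A : Type*} [AddCommGroup A] {n : ℕ}
    (f : Fin (n + 1) → Fin n → A)
    (hf : ∀ i j : Fin n, j ≤ i → f i.succ j = f j.castSucc i) :
    ∑ i : Fin (n + 1), ∑ j : Fin n, ((-1 : ℤ) ^ ((i : ℕ) + (j : ℕ))) • f i j = 0 := by
  rw [← Fintype.sum_prod_type' (f := fun (i : Fin (n + 1)) (j : Fin n) =>
    ((-1 : ℤ) ^ ((i : ℕ) + (j : ℕ))) • f i j),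
    ← Finset.sum_filter_add_sum_filter_not Finset.univ
      (fun p : Fin (n + 1) × Fin n => (p.2 : ℕ) < (p.1 : ℕ)), add_eq_zero_iff_eq_neg,
    ← Finset.sum_neg_distrib]
  refine Finset.sum_bij'
    (fun p hp => (p.2.castSucc, ⟨(p.1 : ℕ) - 1, by
      have := (Finset.mem_filter.1 hp).2
      have := p.1.isLt
      have := p.2.isLt
      omega⟩))
    (fun p _ => (p.2.succ, ⟨(p.1 : ℕ), by
      have := (Finset.mem_filter.1 ‹_›).2
      have := p.2.isLt
      omega⟩)) ?_ ?_ ?_ ?_ ?_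
  · rintro ⟨i, j⟩ hp
    simp only [Finset.mem_filter, Finset.mem_univ, true_and, Fin.val_castSucc] at hp ⊢
    omega
  · rintro ⟨i, j⟩ hp
    simp only [Finset.mem_filter, Finset.mem_univ, true_and, Fin.val_succ] at hp ⊢
    omega
  · rintro ⟨i, j⟩ hp
    simp only [Finset.mem_filter, Finset.mem_univ, true_and] at hp
    simp only [Prod.mk.injEq, Fin.ext_iff, Fin.val_succ, Fin.val_castSucc, and_true]
    omega
  · rintro ⟨i, j⟩ hp
    simp
  · rintro ⟨i, j⟩ hp
    simp only [Finset.mem_filter, Finset.mem_univ, true_and] at hp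
    obtain ⟨k, rfl⟩ : ∃ k : Fin n, i = k.succ :=
      Fin.exists_succ_eq.2 (by rintro rfl; simp at hp) |>.imp fun _ h => h.symm
    have hjk : j ≤ k := by
      rw [Fin.le_def]
      simp only [Fin.val_succ] at hp
      omega
    simp only [Fin.val_succ, Nat.add_sub_cancel, Fin.eta, Fin.val_castSucc, hf k j hjk]
    rw [← neg_smul]
    congr 1
    ring

theorem delFace_delFace {n : ℕ} {i j : Fin n} (h : j ≤ i) (a : Fin (n + 2) → S) :
    delFace j.castSucc (delFace i.succ.castSucc a) =
      delFace i.castSucc (delFace j.castSucc.castSucc a) := by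
  funext k
  rw [Fin.le_def] at h
  simp only [delFace, Fin.val_castSucc, Fin.val_succ]
  split_ifs <;> first | rfl | omega

theorem delFace_delCircFace (V : VFB S) {n : ℕ} {i j : Fin n} (h : j ≤ i)
    (a : Fin (n + 2) → S) :
    delFace j.castSucc (delCircFace V i.succ.castSucc a) =
      delCircFace V i.castSucc (delFace j.castSucc.castSucc a) := by
  funext k
  have hi := i.isLt
  have hk := k.isLt
  rw [Fin.le_def] at h
  simp only [delFace, delCircFace, Fin.val_castSucc, Fin.val_succ, Fin.val_last]
  split_ifs <;> first | rfl | omega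

theorem delCircFace_delFace (V : VFB S) {n : ℕ} {i j : Fin n} (h : j ≤ i)
    (a : Fin (n + 2) → S) :
    delCircFace V j.castSucc (delFace i.succ.castSucc a) =
      delFace i.castSucc (delCircFace V j.castSucc.castSucc a) := by
  funext k
  have hi := i.isLt
  have hk := k.isLt
  rw [Fin.le_def] at h
  simp only [delFace, delCircFace, Fin.val_castSucc, Fin.val_succ, Fin.val_last]
  split_ifs <;> first | rfl | omega

theorem delCircFace_delCircFace (V : VFB S) {n : ℕ} {i j : Fin n} (h : j ≤ i)
    (a : Fin (n + 2) → S) :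
    delCircFace V j.castSucc (delCircFace V i.succ.castSucc a) =
      delCircFace V i.castSucc (delCircFace V j.castSucc.castSucc a) := by
  funext k
  have hi := i.isLt
  have hk := k.isLt
  rw [Fin.le_def] at h
  simp only [delCircFace, Fin.val_castSucc, Fin.val_succ, Fin.val_last]
  split_ifs <;> first | rfl | omega | exact V.circ_circ_comm _ _ _

theorem C.hom_ext {A : Type*} [AddCommGroup A] {n : ℕ} {f g : C S n →+ A}
    (h : ∀ a, f (C.of a) = g (C.of a)) : f = g :=
  FreeAbelianGroup.lift_ext f g h

/-- The difference of the two `i`-th faces, extended to the chain groups. -/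
def faceDiff (V : VFB S) {n : ℕ} (i : Fin (n + 1)) : C S (n + 1) →+ C S n :=
  FreeAbelianGroup.lift fun a : Fin (n + 1) → S =>
    C.of (delFace i a) - C.of (delCircFace V i a)

theorem faceDiff_of (V : VFB S) {n : ℕ} (i : Fin (n + 1)) (a : Fin (n + 1) → S) :
    faceDiff V i (C.of a) = C.of (delFace i a) - C.of (delCircFace V i a) :=
  FreeAbelianGroup.lift_apply_of _ _

theorem dbdry_of (V : VFB S) {n : ℕ} (a : Fin (n + 1) → S) :
    dbdry V (C.of a) = ∑ i : Fin n, ((-1 : ℤ) ^ ((i : ℕ) + 1)) •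
      (C.of (delFace i.castSucc a) - C.of (delCircFace V i.castSucc a)) :=
  FreeAbelianGroup.lift_apply_of _ _

theorem dbdry_eq_sum_faceDiff (V : VFB S) {n : ℕ} :
    (dbdry V : C S (n + 1) →+ C S n) =
      ∑ i : Fin n, ((-1 : ℤ) ^ ((i : ℕ) + 1)) • faceDiff V i.castSucc := by
  refine C.hom_ext fun a => ?_
  simp only [dbdry_of, AddMonoidHom.finsetSum_apply, AddMonoidHom.smul_apply, faceDiff_of]

theorem faceDiff_faceDiff (V : VFB S) {n : ℕ} {i j : Fin n} (h : j ≤ i) (x : C S (n + 2)) :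
    faceDiff V j.castSucc (faceDiff V i.succ.castSucc x) =
      faceDiff V i.castSucc (faceDiff V j.castSucc.castSucc x) := by
  suffices (faceDiff V j.castSucc).comp (faceDiff V i.succ.castSucc) =
      (faceDiff V i.castSucc).comp (faceDiff V j.castSucc.castSucc) from
    DFunLike.congr_fun this x
  refine C.hom_ext fun a => ?_
  simp only [AddMonoidHom.comp_apply, faceDiff_of, map_sub]
  rw [delFace_delFace h, delFace_delCircFace V h, delCircFace_delFace V h,
    delCircFace_delCircFace V h]
  abel

theorem stmt_13 (V : VFB S) (n : ℕ) (x : C S (n + 2)) :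
    dbdry V (dbdry V x) = 0 := by
  have h := Fin.sum_sum_alternating_eq_zero
    (fun (i : Fin (n + 1)) (j : Fin n) => faceDiff V j.castSucc (faceDiff V i.castSucc x))
    (fun i j h => faceDiff_faceDiff V h x)
  rw [dbdry_eq_sum_faceDiff V (n := n + 1), AddMonoidHom.finsetSum_apply, map_sum, ← h]
  refine Finset.sum_congr rfl fun i _ => ?_
  rw [AddMonoidHom.smul_apply, map_zsmul, dbdry_eq_sum_faceDiff, AddMonoidHom.finsetSum_apply,
    Finset.smul_sum]
  refine Finset.sum_congr rfl fun j _ => ?_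
  rw [AddMonoidHom.smul_apply, smul_smul]
  congr 1
  ring
end
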